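/- Let K be a field of characteristic 2, let m >= 5, and let G be the group of order 2^m with presentation <a, c, d | a^{2^{m-2}} = c^2 = d^2 = 1, (d,a) = (d,c) = 1, (c,a) = a^2 d>. Then the group algebra KG has a filtered multiplicative K-basis. -/

import Mathlib

/-- `B` is a *filtered multiplicative `K`-basis* of the `K`-algebra `A`:
(0) `B` is a `K`-basis of `A` (linearly independent and spanning);
(1) the product of two elements of `B` is either `0` or again an element of `B`;
(2) `B ∩ rad(A)` is a `K`-basis of the Jacobson radical `rad(A)` of `A`. -/
def IsFilteredMultiplicativeBasis (K : Type*) {A : Type*} [Field K] [Ring A] [Algebra K A]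
    (B : Set A) : Prop :=
  LinearIndependent K ((↑) : B → A) ∧
  Submodule.span K B = ⊤ ∧
  (∀ b₁ ∈ B, ∀ b₂ ∈ B, b₁ * b₂ = 0 ∨ b₁ * b₂ ∈ B) ∧
  LinearIndependent K ((↑) : ↥(B ∩ (((⊥ : Ideal A).jacobson : Ideal A) : Set A)) → A) ∧
  Submodule.span K (B ∩ (((⊥ : Ideal A).jacobson : Ideal A) : Set A)) =
    Submodule.restrictScalars K ((⊥ : Ideal A).jacobson)

open Submodule in
/-- If the monoid generated by `s` spans `A`, has at most `finrank K A` nonzero elements, and `s`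
lies in the Jacobson radical, then its nonzero elements form a filtered multiplicative basis. -/
theorem isFilteredMultiplicativeBasis_closure {K A : Type*} [Field K] [Ring A] [Algebra K A]
    [Nontrivial A] {s T : Set A} (hspan : Algebra.adjoin K s = ⊤)
    (hrad : s ⊆ ((⊥ : Ideal A).jacobson : Ideal A)) (hT : T.Finite)
    (hcard : T.ncard ≤ Module.finrank K A)
    (hsub : ∀ x ∈ Submonoid.closure s, x = 0 ∨ x ∈ T) :
    IsFilteredMultiplicativeBasis K {x : A | x ∈ Submonoid.closure s ∧ x ≠ 0} := by
  set B : Set A := {x : A | x ∈ Submonoid.closure s ∧ x ≠ 0}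
  set J : Ideal A := (⊥ : Ideal A).jacobson with hJ
  have hone : (1 : A) ∉ J := by
    rw [← Ideal.ne_top_iff_one, hJ, Ne, Ideal.jacobson_eq_top_iff]
    exact bot_ne_top
  have hBT : B ⊆ T := fun x hx ↦ (hsub x hx.1).resolve_left hx.2
  have hspanB : span K B = ⊤ := by
    rw [← Algebra.top_toSubmodule, ← hspan, Algebra.adjoin_eq_span]
    refine le_antisymm (span_mono fun x hx ↦ hx.1) (span_le.2 fun x hx ↦ ?_)
    rcases eq_or_ne x 0 with rfl | h0
    · exact zero_mem _
    · exact subset_span ⟨hx, h0⟩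
  have hlin : LinearIndependent K ((↑) : B → A) := by
    have := (hT.subset hBT).fintype
    refine linearIndependent_of_top_le_span_of_card_le_finrank (by simp [hspanB]) ?_
    rw [← Nat.card_eq_fintype_card]
    exact (Set.ncard_le_ncard hBT hT).trans hcard
  have hBJ : ∀ x ∈ Submonoid.closure s, x = 1 ∨ x ∈ J := fun x hx ↦ by
    induction hx using Submonoid.closure_induction_right with
    | one => exact Or.inl rfl
    | mul_right x _ y hy _ => exact Or.inr (J.mul_mem_left x (hrad hy))
  refine ⟨hlin, hspanB, fun x hx y hy ↦ ?_, 
    LinearIndepOn.mono (v := id) hlin Set.inter_subset_left,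
    le_antisymm (span_le.2 fun x hx ↦ hx.2) fun x hx ↦ ?_⟩
  · by_cases h : x * y = 0
    · exact Or.inl h
    · exact Or.inr ⟨mul_mem hx.1 hy.1, h⟩
  · have hle : span K B ≤ span K {1} ⊔ span K (B ∩ (J : Set A)) := by
      rw [← span_union]
      refine span_mono fun y hy ↦ ?_
      exact (hBJ y hy.1).imp id fun h ↦ ⟨hy, h⟩
    obtain ⟨y, hy, z, hz, rfl⟩ := mem_sup.1 (hle (hspanB ▸ mem_top : x ∈ span K B))
    obtain ⟨r, rfl⟩ := mem_span_singleton.1 hy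
    have hzJ : z ∈ J.restrictScalars K := span_le.2 (fun x hx ↦ hx.2) hz
    have hr : r • (1 : A) ∈ J.restrictScalars K := by simpa using sub_mem hx hzJ
    rcases eq_or_ne r 0 with rfl | hr0
    · simpa using hz
    · refine absurd ?_ hone
      simpa [smul_smul, hr0] using (J.restrictScalars K).smul_mem r⁻¹ hr

/-- An element that is central and square-zero modulo the Jacobson radical lies in it. -/
theorem mem_jacobson_bot_of_mul_self_mem {A : Type*} [Ring A] {x : A}
    (hx : x * x ∈ (⊥ : Ideal A).jacobson)
    (hcomm : ∀ y, x * y - y * x ∈ (⊥ : Ideal A).jacobson) : x ∈ (⊥ : Ideal A).jacobson := by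
  refine Ideal.mem_jacobson_iff.2 fun y ↦ ?_
  have ht : (y * x) * (y * x) ∈ (⊥ : Ideal A).jacobson := by
    have h1 := Ideal.mul_mem_left _ y (Ideal.mul_mem_right x _ (hcomm y))
    have h2 := Ideal.mul_mem_left _ (y * y) hx
    convert add_mem h1 h2 using 1
    noncomm_ring
  obtain ⟨z, hz⟩ := Ideal.mem_jacobson_iff.1 ht (-1)
  refine ⟨z * (1 - y * x), ?_⟩
  convert hz using 1
  noncomm_ring

/-- Centrality modulo the Jacobson radical can be checked on algebra generators. -/
theorem commutator_mem_jacobson_bot_of_adjoin_eq_top {K A : Type*} [Field K] [Ring A] [Algebra K A]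
    {s : Set A} (hspan : Algebra.adjoin K s = ⊤) {x : A}
    (h : ∀ y ∈ s, x * y - y * x ∈ (⊥ : Ideal A).jacobson) (y : A) :
    x * y - y * x ∈ (⊥ : Ideal A).jacobson := by
  have hy : y ∈ Algebra.adjoin K s := hspan ▸ Algebra.mem_top
  induction hy using Algebra.adjoin_induction with
  | mem y hy => exact h y hy
  | algebraMap r => simp [Algebra.commutes]
  | add y z _ _ h1 h2 =>
    convert add_mem h1 h2 using 1
    noncomm_ring
  | mul y z _ _ h1 h2 =>
    convert add_mem (Ideal.mul_mem_right z _ h1) (Ideal.mul_mem_left _ y h2) using 1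
    noncomm_ring

theorem one_add_mul_self_of_charTwo {A : Type*} [Ring A] [CharP A 2] (x : A) :
    (1 + x) * (1 + x) = 1 + x * x := by
  have h : (1 + x) * (1 + x) = 1 + x * x + (x + x) := by noncomm_ring
  rw [h, CharTwo.add_self_eq_zero, add_zero]

section Words

variable {A : Type*} [Ring A]

/-- The alternating words in `u` and `v` of length at most `2 * N`, multiplied by `1` or `v ^ 2`. -/
def alternatingWord (u v : A) (N : ℕ) : Fin 2 × Fin N × Fin 4 → A := fun p ↦
  (v * v) ^ (p.1 : ℕ) * ![(u * v) ^ (p.2.1 : ℕ), (v * u) ^ (p.2.1 + 1 : ℕ),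
    (u * v) ^ (p.2.1 : ℕ) * u, (v * u) ^ (p.2.1 : ℕ) * v] p.2.2

theorem mem_range_alternatingWord {u v : A} {N : ℕ} {x : A} :
    x ∈ Set.range (alternatingWord u v N) ↔ ∃ i < 2, ∃ k < N,
      x = (v * v) ^ i * (u * v) ^ k ∨ x = (v * v) ^ i * (v * u) ^ (k + 1) ∨
      x = (v * v) ^ i * ((u * v) ^ k * u) ∨ x = (v * v) ^ i * ((v * u) ^ k * v) := by
  constructor
  · rintro ⟨⟨i, k, j⟩, rfl⟩
    refine ⟨i, i.2, k, k.2, ?_⟩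
    fin_cases j <;> simp [alternatingWord]
  · rintro ⟨i, hi, k, hk, h | h | h | h⟩
    · exact ⟨(⟨i, hi⟩, ⟨k, hk⟩, 0), by simp [alternatingWord, h]⟩
    · exact ⟨(⟨i, hi⟩, ⟨k, hk⟩, 1), by simp [alternatingWord, h]⟩
    · exact ⟨(⟨i, hi⟩, ⟨k, hk⟩, 2), by simp [alternatingWord, h]⟩
    · exact ⟨(⟨i, hi⟩, ⟨k, hk⟩, 3), by simp [alternatingWord, h]⟩

variable {u v : A} {N : ℕ}

theorem eq_zero_or_mem_range_alternatingWord (hN : 0 < N) (hu : u * u = 0)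
    (hv : (v * v) * (v * v) = 0) (huv : Commute (v * v) u) (hrel : (u * v) ^ N = (v * u) ^ N)
    {x : A} (hx : x ∈ Submonoid.closure {u, v}) :
    x = 0 ∨ x ∈ Set.range (alternatingWord u v N) := by
  have hvv : Commute (v * v) v := (Commute.refl v).mul_left (Commute.refl v)
  have hz1 (k : ℕ) : (u * v) ^ k * (v * v) = (v * v) * (u * v) ^ k :=
    ((huv.mul_right hvv).pow_right k).eq.symm
  have hz2 (k : ℕ) : (v * u) ^ k * (v * v) = (v * v) * (v * u) ^ k :=
    ((hvv.mul_right huv).pow_right k).eq.symm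
  have hword (i k : ℕ) (hk : k < N) {y : A} (hy : y = (u * v) ^ k ∨ y = (v * u) ^ (k + 1) ∨
      y = (u * v) ^ k * u ∨ y = (v * u) ^ k * v) :
      (v * v) ^ i * y = 0 ∨ (v * v) ^ i * y ∈ Set.range (alternatingWord u v N) := by
    by_cases hi : i < 2
    · refine Or.inr (mem_range_alternatingWord.2 ⟨i, hi, k, hk, ?_⟩)
      rcases hy with rfl | rfl | rfl | rfl <;> simp
    · obtain ⟨j, rfl⟩ := Nat.exists_eq_add_of_le (not_lt.1 hi)
      exact Or.inl (by rw [pow_add, pow_two, hv, zero_mul, zero_mul])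
  have huvu (k : ℕ) : (u * v) ^ k * u * v = (u * v) ^ (k + 1) := by rw [pow_succ, mul_assoc]
  have hvuv (k : ℕ) : (v * u) ^ k * v * u = (v * u) ^ (k + 1) := by rw [pow_succ, mul_assoc]
  have huvv (k : ℕ) : (u * v) ^ (k + 1) * v = (v * v) * ((u * v) ^ k * u) := by
    rw [pow_succ, mul_assoc, mul_assoc u v v, ← huv.eq, ← mul_assoc, hz1, mul_assoc]
  induction hx using Submonoid.closure_induction_right with
  | one => simpa using hword 0 0 hN (Or.inl rfl)
  | mul_right x _ y hy ih =>
    rcases ih with rfl | ih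
    · simp
    obtain ⟨i, -, k, hk, h⟩ := mem_range_alternatingWord.1 ih
    rcases hy with rfl | hy
    · rcases h with rfl | rfl | rfl | rfl
      · rw [mul_assoc]
        exact hword i k hk (by simp)
      · exact Or.inl (by rw [pow_succ, mul_assoc, mul_assoc, mul_assoc, hu]; simp)
      · exact Or.inl (by rw [mul_assoc, mul_assoc, hu]; simp)
      · rw [mul_assoc, hvuv]
        exact hword i k hk (by simp)
    · obtain rfl : y = v := hy
      rcases h with rfl | rfl | rfl | rfl
      · rw [mul_assoc]
        rcases k with _ | k
        · exact hword i 0 hk (by simp)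
        · rw [huvv, ← mul_assoc, ← pow_succ]
          exact hword (i + 1) k (by lia) (by simp)
      · rw [mul_assoc]
        rcases (show k + 1 < N ∨ k + 1 = N by lia) with h | rfl
        · exact hword i (k + 1) h (by simp)
        · rw [← hrel, huvv, ← mul_assoc, ← pow_succ]
          exact hword (i + 1) k hk (by simp)
      · rw [mul_assoc, huvu]
        rcases (show k + 1 < N ∨ k + 1 = N by lia) with h | rfl
        · exact hword i (k + 1) h (by simp)
        · rw [hrel]
          exact hword i k hk (by simp)
      · rw [mul_assoc, mul_assoc, hz2, ← mul_assoc, ← pow_succ]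
        rcases k with _ | k
        · exact hword (i + 1) 0 hk (by simp)
        · exact hword (i + 1) k (by lia) (by simp)

theorem subset_jacobson_bot_of_relations {K : Type*} [Field K] [Algebra K A] [CharP A 2]
    (hspan : Algebra.adjoin K {u, v} = ⊤) (hu : u * u = 0)
    (hv : (v * v) * (v * v) = 0) (huv : Commute (v * v) u) {k : ℕ}
    (hrel : (u * v + v * u) ^ 2 ^ k = 0) :
    ({u, v} : Set A) ⊆ ((⊥ : Ideal A).jacobson : Ideal A) := by
  set J : Ideal A := (⊥ : Ideal A).jacobson
  have hvv : Commute (v * v) v := (Commute.refl v).mul_left (Commute.refl v)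
  have key {x : A} (h : x * x ∈ J) (h1 : x * u - u * x ∈ J) (h2 : x * v - v * x ∈ J) : x ∈ J := by
    refine mem_jacobson_bot_of_mul_self_mem h
      (commutator_mem_jacobson_bot_of_adjoin_eq_top hspan ?_)
    rintro y (rfl | rfl)
    exacts [h1, h2]
  have hxu : Commute (u * v + v * u) u := by
    simp only [Commute, SemiconjBy, add_mul, mul_add]
    rw [mul_assoc v u u, ← mul_assoc u u v, hu]
    simp [mul_assoc]
  have hxv : Commute (u * v + v * u) v := by
    simp only [Commute, SemiconjBy, add_mul, mul_add]
    rw [mul_assoc u v v, ← huv.eq, ← mul_assoc v v u, add_comm]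
    simp [mul_assoc]
  have hpow (j : ℕ) : (u * v + v * u) ^ 2 ^ (k - j) ∈ J := by
    induction j with
    | zero => simp [hrel]
    | succ j ih =>
      rcases (show k - j = k - (j + 1) + 1 ∨ k - j = k - (j + 1) by lia) with h | h
      · refine key ?_ ?_ ?_
        · rwa [← pow_two, ← pow_mul, ← pow_succ, ← h]
        · rw [(hxu.pow_left _).eq, sub_self]; exact zero_mem _
        · rw [(hxv.pow_left _).eq, sub_self]; exact zero_mem _
      · rwa [← h]
  have hx : u * v + v * u ∈ J := by simpa using hpow k
  rintro y (rfl | rfl)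
  · refine key (by simp [hu]) (by simp) ?_
    rwa [CharTwo.sub_eq_add]
  · refine key (key (by simp [hv]) ?_ ?_) ?_ (by simp)
    · rw [huv.eq, sub_self]; exact zero_mem _
    · rw [hvv.eq, sub_self]; exact zero_mem _
    · rwa [CharTwo.sub_eq_add, add_comm]

theorem exists_isFilteredMultiplicativeBasis_of_relations {K : Type*} [Field K] [Algebra K A]
    [Nontrivial A] [CharP A 2] (hspan : Algebra.adjoin K {u, v} = ⊤) (hu : u * u = 0)
    (hv : (v * v) * (v * v) = 0) (huv : Commute (v * v) u) {k : ℕ}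
    (hrel : (u * v + v * u) ^ 2 ^ k = 0) (hdim : Module.finrank K A = 2 ^ (k + 3)) :
    ∃ B : Set A, IsFilteredMultiplicativeBasis K B := by
  have hcomm : Commute (u * v) (v * u) := by
    have h1 : u * v * (v * u) = (v * v) * (u * u) := by
      rw [mul_assoc u v, ← mul_assoc v v u, ← mul_assoc, ← huv.eq, mul_assoc (v * v)]
    have h2 : v * u * (u * v) = v * (u * u) * v := by simp [mul_assoc]
    rw [Commute, SemiconjBy, h1, h2, hu]
    simp
  have hrel' : (u * v) ^ 2 ^ k = (v * u) ^ 2 ^ k := by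
    rwa [add_pow_char_pow_of_commute 2 k hcomm, CharTwo.add_eq_zero] at hrel
  refine ⟨_, isFilteredMultiplicativeBasis_closure hspan
    (subset_jacobson_bot_of_relations hspan hu hv huv hrel) (Set.finite_range _) ?_
    fun x hx ↦ eq_zero_or_mem_range_alternatingWord (pow_pos two_pos k) hu hv huv hrel' hx⟩
  refine (Finite.card_range_le _).trans ?_
  simp only [Nat.card_eq_fintype_card, Fintype.card_prod, Fintype.card_fin, hdim, pow_add]
  lia

end Words

/-- The group `G₁₃ = ⟨a, c, d ∣ a^(2^(m-2)) = c² = d² = 1, (d,a) = (d,c) = 1, (c,a) = a²d⟩` of order `2^m`, `m ≥ 5`: in characteristic `2`, `KG` has a filtered multiplicative `K`-basis. -/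
theorem filtered_mult_basis_G13 (K : Type*) [Field K] [CharP K 2] (m : ℕ) (hm : 5 ≤ m)
    (G : Type*) [Group G] [Fintype G] (hcard : Nat.card G = 2 ^ m)
    (a c d : G) (hgen : Subgroup.closure {a, c, d} = (⊤ : Subgroup G))
    (ha : a ^ 2 ^ (m - 2) = 1) (hc : c ^ 2 = 1) (hd : d ^ 2 = 1)
    (hda : d⁻¹ * a⁻¹ * d * a = 1) (hdc : d⁻¹ * c⁻¹ * d * c = 1)
    (hca : c⁻¹ * a⁻¹ * c * a = a ^ 2 * d) :
    ∃ B : Set (MonoidAlgebra K G), IsFilteredMultiplicativeBasis K B := by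
  have hda' : d * a = a * d := by
    have : d⁻¹ * a⁻¹ * d * a = (a * d)⁻¹ * (d * a) := by group
    rw [this, inv_mul_eq_one] at hda
    exact hda.symm
  have hdc' : d * c = c * d := by
    have : d⁻¹ * c⁻¹ * d * c = (c * d)⁻¹ * (d * c) := by group
    rw [this, inv_mul_eq_one] at hdc
    exact hdc.symm
  have hcc : c * c = 1 := by rw [← pow_two, hc]
  have hci : c⁻¹ = c := inv_eq_of_mul_eq_one_left hcc
  have hcac : c * a⁻¹ * c = a * d := by
    rw [hci, ← eq_mul_inv_iff_mul_eq] at hca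
    rw [hca, mul_inv_eq_iff_eq_mul, mul_assoc a d, hda', ← mul_assoc, pow_two]
  have hcac' : c * a * c = a⁻¹ * d := by
    have h := congrArg (·⁻¹) hcac
    simp only [mul_inv_rev, inv_inv, hci] at h
    have hdi : d⁻¹ = d := inv_eq_of_mul_eq_one_left (by rw [← pow_two, hd])
    rw [← mul_assoc, hdi] at h
    rw [h]
    exact (Commute.inv_right (show Commute d a from hda')).eq
  have hdac : (a * c) * (a * c) = d := by
    rw [mul_assoc, ← mul_assoc c, hcac', mul_inv_cancel_left]
  obtain ⟨k, rfl⟩ : ∃ k, m = k + 1 + 3 := ⟨m - 4, by lia⟩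
  have hpow : (c * a * c) ^ 2 ^ (k + 1) = a ^ 2 ^ (k + 1) := by
    rw [hcac', (Commute.inv_left (show Commute a d from hda'.symm)).mul_pow]
    rw [pow_succ' 2 k, pow_mul d, hd, one_pow, mul_one, ← pow_succ', inv_pow, inv_eq_iff_mul_eq_one,
      ← pow_add, ← mul_two, ← pow_succ]
    exact ha
  have : CharP (MonoidAlgebra K G) 2 :=
    charP_of_injective_algebraMap (algebraMap K (MonoidAlgebra K G)).injective 2
  let f := MonoidAlgebra.of K G
  have hfc : f c * f c = 1 := by rw [← map_mul, hcc, map_one]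
  have hfd : f d * f d = 1 := by rw [← map_mul, ← pow_two, hd, map_one]
  have hv : (1 + f (a * c)) * (1 + f (a * c)) = 1 + f d := by
    rw [one_add_mul_self_of_charTwo, ← map_mul, hdac]
  refine exists_isFilteredMultiplicativeBasis_of_relations (K := K) (k := k + 1) (u := 1 + f c)
    (v := 1 + f (a * c)) ?_ ?_ ?_ ?_ ?_ ?_
  · set S := Algebra.adjoin K {1 + f c, 1 + f (a * c)}
    have h1 : f c ∈ S := by
      have h := sub_mem (Algebra.subset_adjoin (R := K) (by simp) : 1 + f c ∈ S) (one_mem S)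
      rwa [add_sub_cancel_left] at h
    have h2 : f (a * c) ∈ S := by
      have h := sub_mem (Algebra.subset_adjoin (R := K) (by simp) : 1 + f (a * c) ∈ S) (one_mem S)
      rwa [add_sub_cancel_left] at h
    have h3 : f a ∈ S := by
      have h := mul_mem h2 h1
      rwa [← map_mul, mul_assoc, hcc, mul_one] at h
    have h4 : f d ∈ S := by
      have h := mul_mem h2 h2
      rwa [← map_mul, hdac] at h
    have hG (g : G) : f g ∈ S := by
      have hg : g ∈ Submonoid.closure {a, c, d} := by
        rw [← Subgroup.closure_toSubmonoid_of_finite, hgen]; trivial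
      induction hg using Submonoid.closure_induction with
      | mem x hx => rcases hx with rfl | rfl | rfl <;> assumption
      | one => rw [map_one]; exact one_mem S
      | mul x y _ _ hx hy => rw [map_mul]; exact mul_mem hx hy
    refine eq_top_iff.2 fun x _ ↦ ?_
    induction x using MonoidAlgebra.induction_on with
    | of g => exact hG g
    | add x y hx hy => exact add_mem (hx trivial) (hy trivial)
    | smul r x hx => exact S.smul_mem (hx trivial) r
  · rw [one_add_mul_self_of_charTwo, hfc, CharTwo.add_self_eq_zero]
  · rw [hv, one_add_mul_self_of_charTwo, hfd, CharTwo.add_self_eq_zero]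
  · rw [hv]
    have h : Commute (f d) (f c) := (show Commute d c from hdc').map f
    exact (Commute.one_left _).add_left ((Commute.one_right _).add_right h)
  · have hx : (1 + f c) * (1 + f (a * c)) + (1 + f (a * c)) * (1 + f c) = f (c * a * c) + f a := by
      have h1 : f c * f (a * c) = f (c * a * c) := by rw [← map_mul, mul_assoc]
      have h2 : f (a * c) * f c = f a := by rw [← map_mul, mul_assoc, hcc, mul_one]
      calc _ = f c * f (a * c) + f (a * c) * f c + ((1 + f c + f (a * c)) + (1 + f c + f (a * c))) := by
            noncomm_ring
        _ = _ := by rw [CharTwo.add_self_eq_zero, add_zero, h1, h2]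
    have hcomm : Commute (c * a * c) a := by
      rw [hcac']
      exact ((Commute.refl a).inv_left).mul_left hda'
    rw [hx, add_pow_char_pow_of_commute 2 _ (hcomm.map f), ← map_pow, ← map_pow, hpow,
      CharTwo.add_self_eq_zero]
  · rw [Module.finrank_eq_card_basis (MonoidAlgebra.basis G K), ← Nat.card_eq_fintype_card, hcard]
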